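/- arXiv:1503.00275 — 9 statements merged into one kernel-verified Lean document; each statement's English description precedes it below -/
import Mathlib

section
/- Let L be a bounded lattice and let n, m be natural numbers. Set N = n + 2·n·(n−1)·m. There exist a comparator circuit U on N lines over L with exactly 4·n·(n−1)·m gates, and a function E assigning to every comparator circuit G on n lines over L with exactly m gates an assignment E(G) of values from {⊥, ⊤} to the last N − n lines, such that for every initial assignment v : Fin n → L, the restriction to the first n lines of eval U (v ⧺ E(G)) equals eval G v, where v ⧺ E(G) denotes the assignment on Fin N whose first n coordinates are given by v and whose remaining coordinates are given by E(G). -/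
/-- Apply a single comparator gate `(i, j)`: line `i` receives the meet and
line `j` receives the join of the old values of lines `i` and `j`. -/
def applyGate {L : Type*} [Lattice L] {n : ℕ} (v : Fin n → L) (g : Fin n × Fin n) :
    Fin n → L :=
  fun k => if k = g.1 then v g.1 ⊓ v g.2 else if k = g.2 then v g.1 ⊔ v g.2 else v k

/-- Evaluate a comparator circuit (a list of gates) on an initial assignment. -/
def evalCC {L : Type*} [Lattice L] {n : ℕ} (G : List (Fin n × Fin n)) (v : Fin n → L) :
    Fin n → L :=
  G.foldl applyGate v

set_option linter.unusedSimpArgs false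

/-- The conditional comparator on lines `i`, `j` with control lines `p`, `q`. -/
def ccGadget {N : ℕ} (i j p q : Fin N) : List (Fin N × Fin N) :=
  [(p, i), (p, j), (p, q), (i, q)]

/-- Lines other than the four lines of the gadget are unchanged. -/
lemma ccGadget_other {L : Type*} [Lattice L] {N : ℕ} (i j p q k : Fin N) (w : Fin N → L)
    (hi : k ≠ i) (hj : k ≠ j) (hp : k ≠ p) (hq : k ≠ q) :
    evalCC (ccGadget i j p q) w k = w k := by
  simp [evalCC, ccGadget, applyGate, hi, hj, hp, hq]

/-- With control values `⊤, ⊥` the gadget acts as a comparator. -/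
lemma ccGadget_on {L : Type*} [Lattice L] [BoundedOrder L] {N : ℕ} (i j p q : Fin N)
    (w : Fin N → L) (hij : i ≠ j) (hip : i ≠ p) (hiq : i ≠ q) (hjp : j ≠ p) (hjq : j ≠ q)
    (hpq : p ≠ q) (wp : w p = ⊤) (wq : w q = ⊥) :
    evalCC (ccGadget i j p q) w i = w i ⊓ w j ∧ evalCC (ccGadget i j p q) w j = w i ⊔ w j := by
  simp [evalCC, ccGadget, applyGate, hij, hip, hiq, hjp, hjq, hpq, hij.symm, hip.symm, hiq.symm,
    hjp.symm, hjq.symm, hpq.symm, wp, wq]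

/-- With control values `⊥, ⊤` the gadget does nothing to its data lines. -/
lemma ccGadget_off {L : Type*} [Lattice L] [BoundedOrder L] {N : ℕ} (i j p q : Fin N)
    (w : Fin N → L) (hij : i ≠ j) (hip : i ≠ p) (hiq : i ≠ q) (hjp : j ≠ p) (hjq : j ≠ q)
    (hpq : p ≠ q) (wp : w p = ⊥) (wq : w q = ⊤) :
    evalCC (ccGadget i j p q) w i = w i ∧ evalCC (ccGadget i j p q) w j = w j := by
  simp [evalCC, ccGadget, applyGate, hij, hip, hiq, hjp, hjq, hpq, hij.symm, hip.symm, hiq.symm,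
    hjp.symm, hjq.symm, hpq.symm, wp, wq]

/-- A sequence of gadgets with fresh control lines simulates the enabled gates. -/
lemma evalCC_gadgets {L : Type*} [Lattice L] [BoundedOrder L] {n M : ℕ} {κ : Type*}
    (P : κ → Fin n × Fin n) (hP : ∀ k, (P k).1 ≠ (P k).2)
    (c : κ × Bool → Fin M) (hc : Function.Injective c) (b : κ → Bool) :
    ∀ (l : List κ), l.Nodup → ∀ w : Fin (n + M) → L,
      (∀ k ∈ l, ∀ s, w (Fin.natAdd n (c (k, s))) = if b k = s then ⊤ else ⊥) →
      (fun i : Fin n => evalCC (l.flatMap fun k => ccGadget (Fin.castAdd M (P k).1)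
        (Fin.castAdd M (P k).2) (Fin.natAdd n (c (k, true))) (Fin.natAdd n (c (k, false)))) w
        (Fin.castAdd M i)) = evalCC ((l.filter b).map P) (fun i => w (Fin.castAdd M i)) := by
  have hcn : ∀ (a : Fin n) (d : Fin M), Fin.castAdd M a ≠ Fin.natAdd n d := by
    intro a d h
    have := congrArg Fin.val h
    simp at this
    omega
  intro l
  induction l with
  | nil => intro _ w _; rfl
  | cons k l ih =>
    intro hl w hw
    rw [List.nodup_cons] at hl
    have hij : Fin.castAdd M (P k).1 ≠ Fin.castAdd M (P k).2 := fun h =>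
      hP k (Fin.castAdd_injective n M h)
    have hpq : Fin.natAdd n (c (k, true)) ≠ Fin.natAdd n (c (k, false)) := fun h => by
      have := hc (Fin.natAdd_injective M n h)
      simp at this
    set w' := evalCC (ccGadget (Fin.castAdd M (P k).1)
        (Fin.castAdd M (P k).2) (Fin.natAdd n (c (k, true))) (Fin.natAdd n (c (k, false)))) w
      with hw'
    have key := ih hl.2 w' (by
      intro k' hk' s
      rw [← hw k' (List.mem_cons_of_mem _ hk') s]
      have hne : ∀ s', Fin.natAdd n (c (k', s)) ≠ Fin.natAdd n (c (k, s')) := by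
        intro s' h
        have := hc (Fin.natAdd_injective M n h)
        simp only [Prod.mk.injEq] at this
        exact hl.1 (this.1 ▸ hk')
      exact ccGadget_other _ _ _ _ _ _ (hcn _ _).symm (hcn _ _).symm (hne _) (hne _))
    have step : (fun i => w' (Fin.castAdd M i)) =
        if b k then applyGate (fun i => w (Fin.castAdd M i)) (P k)
        else fun i => w (Fin.castAdd M i) := by
      have hp := hw k List.mem_cons_self true
      have hq := hw k List.mem_cons_self false
      have other : ∀ i, i ≠ (P k).1 → i ≠ (P k).2 → w' (Fin.castAdd M i) = w (Fin.castAdd M i) :=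
        fun i h1 h2 => ccGadget_other _ _ _ _ _ _
          (fun h => h1 (Fin.castAdd_injective n M h)) (fun h => h2 (Fin.castAdd_injective n M h))
          (hcn _ _) (hcn _ _)
      cases hb : b k with
      | true =>
        have := ccGadget_on _ _ _ _ w hij (hcn _ _) (hcn _ _) (hcn _ _) (hcn _ _) hpq
          (by simpa [hb] using hp) (by simpa [hb] using hq)
        rw [← hw'] at this
        funext i
        simp only [if_true, applyGate]
        split_ifs with h1 h2
        · rw [h1]; exact this.1
        · rw [h2]; exact this.2
        · exact other i h1 h2
      | false =>
        have := ccGadget_off _ _ _ _ w hij (hcn _ _) (hcn _ _) (hcn _ _) (hcn _ _) hpq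
          (by simpa [hb] using hp) (by simpa [hb] using hq)
        rw [← hw'] at this
        funext i
        simp only [Bool.false_eq_true, if_false]
        by_cases h1 : i = (P k).1
        · rw [h1]; exact this.1
        by_cases h2 : i = (P k).2
        · rw [h2]; exact this.2
        exact other i h1 h2
    have e1 : ∀ (A B : List (Fin (n + M) × Fin (n + M))),
        evalCC (A ++ B) w = evalCC B (evalCC A w) := fun A B => List.foldl_append ..
    simp only [List.flatMap_cons, e1, ← hw']
    rw [key, step]
    cases hb : b k <;> simp [hb, evalCC]

/-- Selecting in round `t` the `t`-th gate of `G` gives back `G`. -/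
lemma filter_rounds {α : Type*} [DecidableEq α] (S : List α) (hS : S.Nodup) (G : List α)
    (hG : ∀ g ∈ G, g ∈ S) (m : ℕ) (hm : G.length = m) :
    ((((List.finRange m) ×ˢ S).filter fun k => decide (G[k.1.val]? = some k.2)).map Prod.snd)
      = G := by
  subst hm
  have h1 : ∀ t : Fin G.length,
      ((S.map (Prod.mk t)).filter fun k => decide (G[k.1.val]? = some k.2)).map Prod.snd
        = [G.get t] := by
    intro t
    have ht : G.get t ∈ S := hG _ (List.get_mem _ _)
    rw [List.filter_map, List.map_map]
    have : (S.filter ((fun k : Fin G.length × α => decide (G[k.1.val]? = some k.2)) ∘ Prod.mk t))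
        = S.filter (fun x => x == G.get t) := by
      apply List.filter_congr
      intro x _
      simp [eq_comm, Bool.beq_eq_decide_eq]
    rw [this, List.filter_beq, List.count_eq_one_of_mem hS ht]
    simp
  change List.map Prod.snd (List.filter _ (List.flatMap _ _)) = G
  rw [List.filter_flatMap, List.map_flatMap]
  simp only [h1]
  rw [← List.map_eq_flatMap]
  apply List.ext_getElem
  · simp
  · intro i h1 h2
    simp

/-- Existence of a universal comparator circuit over any bounded lattice:
a single circuit `U` on `N = n + 2·n·(n-1)·m` lines with `4·n·(n-1)·m` gates
that simulates every `n`-line, `m`-gate comparator circuit `G` when the extra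
`N - n` lines are fed a suitable `{⊥, ⊤}`-valued encoding `E G` of `G`. -/
theorem universal_comparator_circuit {L : Type*} [Lattice L] [BoundedOrder L] (n m : ℕ) :
    ∃ U : List (Fin (n + 2 * n * (n - 1) * m) × Fin (n + 2 * n * (n - 1) * m)),
      (∀ g ∈ U, g.1 ≠ g.2) ∧ U.length = 4 * n * (n - 1) * m ∧
      ∃ E : List (Fin n × Fin n) → (Fin (2 * n * (n - 1) * m) → L),
        ∀ G : List (Fin n × Fin n), (∀ g ∈ G, g.1 ≠ g.2) → G.length = m →
          (∀ j, E G j = ⊥ ∨ E G j = ⊤) ∧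
          ∀ v : Fin n → L,
            (fun i : Fin n => evalCC U (Fin.append v (E G)) (Fin.castAdd _ i)) = evalCC G v := by
  classical
  let O := {g : Fin n × Fin n // g.1 ≠ g.2}
  have hO : Fintype.card O = n * (n - 1) := by
    have h := Fintype.card_subtype_compl (fun g : Fin n × Fin n => g.1 = g.2)
    have h2 : Fintype.card {g : Fin n × Fin n // g.1 = g.2} = n := by
      rw [Fintype.card_congr (β := Fin n) ⟨fun g => g.1.1, fun a => ⟨(a, a), rfl⟩,
        fun ⟨⟨a, b⟩, h⟩ => by have h' : a = b := h; subst h'; rfl, fun a => rfl⟩, Fintype.card_fin]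
    simp only [O, ne_eq]
    rw [h, h2]
    simp [Nat.mul_sub]
  have hcard : Fintype.card ((Fin m × O) × Bool) = 2 * n * (n - 1) * m := by
    simp only [Fintype.card_prod, hO, Fintype.card_fin, Fintype.card_bool]
    ring
  let e : (Fin m × O) × Bool ≃ Fin (2 * n * (n - 1) * m) := Fintype.equivFinOfCardEq hcard
  let S : List O := Finset.univ.toList
  let l : List (Fin m × O) := (List.finRange m) ×ˢ S
  have hS : S.Nodup := Finset.nodup_toList _
  have hl : l.Nodup := (List.nodup_finRange m).product hS
  have hlen : l.length = m * (n * (n - 1)) := by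
    simp [l, S, List.length_product, ← hO]
  have hcn : ∀ (a : Fin n) (d : Fin (2 * n * (n - 1) * m)),
      Fin.castAdd _ a ≠ Fin.natAdd n d := by
    intro a d h
    have := congrArg Fin.val h
    simp at this
    omega
  let b : List (Fin n × Fin n) → Fin m × O → Bool := fun G k =>
    decide (G[k.1.val]? = some k.2.1)
  refine ⟨l.flatMap fun k => ccGadget (Fin.castAdd _ k.2.1.1) (Fin.castAdd _ k.2.1.2)
    (Fin.natAdd n (e (k, true))) (Fin.natAdd n (e (k, false))), ?_, ?_,
    fun G j => if b G (e.symm j).1 = (e.symm j).2 then ⊤ else ⊥, ?_⟩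
  · intro g hg
    obtain ⟨k, -, hk⟩ := List.mem_flatMap.1 hg
    simp only [ccGadget, List.mem_cons, List.not_mem_nil, or_false] at hk
    rcases hk with rfl | rfl | rfl | rfl
    · exact (hcn _ _).symm
    · exact (hcn _ _).symm
    · intro h
      have := e.injective (Fin.natAdd_injective _ n h)
      simp at this
    · exact hcn _ _
  · rw [List.length_flatMap]
    simp only [ccGadget, List.length_cons, List.length_nil, List.map_const', List.sum_replicate,
      hlen, smul_eq_mul]
    ring
  · intro G hG hm
    refine ⟨fun j => ?_, fun v => ?_⟩
    · dsimp only
      split_ifs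
      · exact Or.inr rfl
      · exact Or.inl rfl
    · rw [evalCC_gadgets (fun k : Fin m × O => k.2.1) (fun k => k.2.2) e e.injective (b G) l hl]
      · have hv : ∀ x : Fin (2 * n * (n - 1) * m) → L,
            (fun i => Fin.append v x (Fin.castAdd _ i)) = v := fun x => by
          funext i; simp
        rw [hv]
        congr 1
        let G' : List O := G.attach.map fun g => ⟨g.1, hG _ g.2⟩
        have hG' : G'.map Subtype.val = G := by
          simp only [G', List.map_map]
          exact List.attach_map_subtype_val G
        have hr := filter_rounds S hS G' (fun g _ => by simp [S]) m (by simp [G', hm])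
        have hb : b G = fun k : Fin m × O => decide (G'[k.1.val]? = some k.2) := by
          funext k
          simp only [b]
          congr 1
          conv_lhs => rw [← hG']
          rw [List.getElem?_map]
          cases G'[k.1.val]? with
          | none => simp
          | some x =>
            simp only [Option.map_some, Option.some.injEq]
            exact propext Subtype.ext_iff.symm
        rw [hb]
        conv_rhs => rw [← hG', ← hr]
        rw [List.map_map]
        rfl
      · intro k _ s
        simp
end

section
/- For all equivalence relations A and B on Fin n with A ≰ B, there exists an equivalence relation C on Fin n such that A ⊔ C = ⊤ and B ⊔ C ≠ ⊤. -/
/-- The lattice-theoretic content of the formula `dist_{A,B}` over the partition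
lattice: for equivalence relations `A ≰ B` on `Fin n` there is an equivalence
relation `C` with `A ⊔ C = ⊤` and `B ⊔ C ≠ ⊤`. -/
theorem exists_dist_constant {n : ℕ} (A B : Setoid (Fin n)) (hAB : ¬ A ≤ B) :
    ∃ C : Setoid (Fin n), A ⊔ C = ⊤ ∧ B ⊔ C ≠ ⊤ := by
  have h : ∃ a b, A a b ∧ ¬ B a b := by
    by_contra hc
    push Not at hc
    exact hAB (fun {x y} hxy => hc x y hxy)
  obtain ⟨a, b, hA, hB⟩ := h
  let C : Setoid (Fin n) := Setoid.ker (fun x => B a x)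
  have hC : ∀ x y, C x y ↔ (B a x ↔ B a y) := fun x y => by
    simp only [C, Setoid.ker_def, eq_iff_iff]
  refine ⟨C, ?_, ?_⟩
  · have hle1 : A ≤ A ⊔ C := le_sup_left
    have hle2 : C ≤ A ⊔ C := le_sup_right
    have key : ∀ x, (A ⊔ C) a x := by
      intro x
      by_cases hx : B a x
      · exact hle2 ((hC a x).2 ⟨fun _ => hx, fun _ => B.refl' a⟩)
      · exact (A ⊔ C).trans' (hle1 hA)
          (hle2 ((hC b x).2 ⟨fun h => absurd h hB, fun h => absurd h hx⟩))
    exact Setoid.eq_top_iff.2 fun x y => (A ⊔ C).trans' ((A ⊔ C).symm' (key x)) (key y)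
  · have hBC : B ≤ C := fun {x y} hxy =>
      (hC x y).2 ⟨fun h => B.trans' h hxy, fun h => B.trans' h (B.symm' hxy)⟩
    rw [sup_eq_right.2 hBC]
    intro ht
    exact hB (((hC a b).1 (Setoid.eq_top_iff.1 ht a b)).1 (B.refl' a))
end

section
/- For every equivalence relation A on Fin n there exists a finite family C_1, …, C_m of equivalence relations on Fin n such that for every equivalence relation x on Fin n: the meet (x ⊔ C_1) ⊓ (x ⊔ C_2) ⊓ ⋯ ⊓ (x ⊔ C_m) equals ⊤ if and only if A ≤ x (where an empty meet is interpreted as ⊤). -/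
/-- The lattice-theoretic content of the formula `checkge_A` over the partition
lattice: for every equivalence relation `A` on `Fin n` there is a finite family
`C 0, …, C (m-1)` of equivalence relations such that for every equivalence
relation `x`, the meet `⨅ i, (x ⊔ C i)` equals `⊤` if and only if `A ≤ x`
(the empty meet being `⊤`). -/
theorem exists_checkge_constants {n : ℕ} (A : Setoid (Fin n)) :
    ∃ (m : ℕ) (C : Fin m → Setoid (Fin n)),
      ∀ x : Setoid (Fin n), (⨅ i : Fin m, x ⊔ C i) = ⊤ ↔ A ≤ x := by
  have hfin : Finite (Setoid (Fin n)) := by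
    refine Finite.of_injective
      (fun (r : Setoid (Fin n)) (p : Fin n × Fin n) => r p.1 p.2) ?_
    intro r s h
    ext a b
    exact iff_of_eq (congrFun h (a, b))
  obtain ⟨m, ⟨e⟩⟩ := Finite.exists_equiv_fin {C : Setoid (Fin n) // A ⊔ C = ⊤}
  refine ⟨m, fun i => (e.symm i).1, fun x => ?_⟩
  rw [iInf_eq_top]
  constructor
  · intro h a b hab
    by_contra hx
    -- the two-block partition: the `x`-class of `a` and its complement
    let C : Setoid (Fin n) := Setoid.ker (fun y => x a y)
    have hxC : x ≤ C := by
      intro u v huv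
      exact propext ⟨fun k => x.trans' k huv, fun k => x.trans' k (x.symm' huv)⟩
    have hAC : A ⊔ C = ⊤ := by
      have key : ∀ u, (A ⊔ C) a u := by
        intro u
        by_cases hu : x a u
        · exact (le_sup_right : C ≤ A ⊔ C)
            (propext ⟨fun _ => hu, fun _ => x.refl' a⟩ : (x a a) = (x a u))
        · exact (A ⊔ C).trans' ((le_sup_left : A ≤ A ⊔ C) hab)
            ((le_sup_right : C ≤ A ⊔ C)
              (propext ⟨fun k => absurd k hx, fun k => absurd k hu⟩ : (x a b) = (x a u)))
      rw [eq_top_iff]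
      intro u v _
      exact (A ⊔ C).trans' ((A ⊔ C).symm' (key u)) (key v)
    have h1 := h (e ⟨C, hAC⟩)
    simp only [Equiv.symm_apply_apply] at h1
    rw [sup_eq_right.mpr hxC] at h1
    have h2 : C a b := by rw [h1]; trivial
    have h3 : (x a a) = (x a b) := h2
    exact hx (h3 ▸ x.refl' a)
  · intro h i
    exact top_le_iff.mp ((e.symm i).2.ge.trans (sup_le_sup_right h _))
end

section
/- For every natural number n and every equivalence relation A on Fin n, there exists a unary lattice term p over the lattice of equivalence relations on Fin n such that for every equivalence relation x on Fin n: if A ≤ x then p evaluates to ⊤ at x, and if A ≰ x then p evaluates to ⊥ at x. -/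
/-- Unary lattice terms over a lattice `L`: built from the single variable,
constants from `L`, and binary meets and joins. -/
inductive LatTerm (L : Type*) where
  | var : LatTerm L
  | const : L → LatTerm L
  | meet : LatTerm L → LatTerm L → LatTerm L
  | join : LatTerm L → LatTerm L → LatTerm L

/-- Evaluation of a unary lattice term at a point of the lattice. -/
def LatTerm.eval {L : Type*} [Lattice L] : LatTerm L → L → L
  | .var, x => x
  | .const a, _ => a
  | .meet p q, x => p.eval x ⊓ q.eval x
  | .join p q, x => p.eval x ⊔ q.eval x

/-- The atom of the partition lattice identifying exactly `a` and `b`. -/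
def pairSetoid {α : Type*} (a b : α) : Setoid α where
  r i j := i = j ∨ (i = a ∧ j = b) ∨ (i = b ∧ j = a)
  iseqv := by
    refine ⟨?_, ?_, ?_⟩
    · intro x; exact Or.inl rfl
    · intro x y h; grind
    · intro x y z h k; grind

/-- The pair `c, d` can be produced from the pair `a, b` by a term. -/
def Reach {α : Type*} (a b c d : α) : Prop :=
  ∃ p : LatTerm (Setoid α), ∀ x : Setoid α,
    (¬ x.r a b → p.eval x = ⊥) ∧ (x.r a b → (p.eval x).r c d)

theorem Reach.symm {α : Type*} {a b c d : α} (h : Reach a b c d) : Reach a b d c := by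
  obtain ⟨p, hp⟩ := h
  exact ⟨p, fun x => ⟨(hp x).1, fun hx => (p.eval x).symm' ((hp x).2 hx)⟩⟩

theorem Reach.trans {α : Type*} {a b c d e : α} (h : Reach a b c d) (k : Reach a b d e) :
    Reach a b c e := by
  obtain ⟨p, hp⟩ := h
  obtain ⟨q, hq⟩ := k
  refine ⟨.join p q, fun x => ⟨fun hx => ?_, fun hx => ?_⟩⟩
  · simp [LatTerm.eval, (hp x).1 hx, (hq x).1 hx]
  · have h1 : p.eval x ≤ p.eval x ⊔ q.eval x := le_sup_left
    have h2 : q.eval x ≤ p.eval x ⊔ q.eval x := le_sup_right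
    exact (p.eval x ⊔ q.eval x).trans' (h1 ((hp x).2 hx)) (h2 ((hq x).2 hx))

theorem inf_pair_eq_bot {α : Type*} {a b : α} {x : Setoid α} (h : ¬ x.r a b) :
    x ⊓ pairSetoid a b = ⊥ := by
  rw [eq_bot_iff]
  rintro i j ⟨h1, h2⟩
  change i = j
  rcases h2 with h2 | ⟨rfl, rfl⟩ | ⟨rfl, rfl⟩
  · exact h2
  · exact absurd h1 h
  · exact absurd (x.symm' h1) h

theorem reach_left {α : Type*} {a b : α} (hab : a ≠ b) (c : α) : Reach a b a c := by
  by_cases hca : c = a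
  · subst hca
    exact ⟨.const ⊥, fun x => ⟨fun _ => rfl, fun _ => Setoid.refl' _ _⟩⟩
  by_cases hcb : c = b
  · subst hcb
    refine ⟨.meet .var (.const (pairSetoid a c)), fun x => ⟨fun hx => inf_pair_eq_bot hx, ?_⟩⟩
    intro hx
    exact ⟨hx, Or.inr (Or.inl ⟨rfl, rfl⟩)⟩
  refine ⟨.meet (.join (.meet .var (.const (pairSetoid a b))) (.const (pairSetoid b c)))
    (.const (pairSetoid a c)), fun x => ⟨fun hx => ?_, fun hx => ?_⟩⟩
  · simp only [LatTerm.eval, inf_pair_eq_bot hx, bot_sup_eq]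
    apply inf_pair_eq_bot
    rintro (h | ⟨h, _⟩ | ⟨h, _⟩)
    · exact hca h.symm
    · exact hab h
    · exact hca h.symm
  · refine ⟨?_, Or.inr (Or.inl ⟨rfl, rfl⟩)⟩
    have h1 : x ⊓ pairSetoid a b ≤ x ⊓ pairSetoid a b ⊔ pairSetoid b c := le_sup_left
    have h2 : pairSetoid b c ≤ x ⊓ pairSetoid a b ⊔ pairSetoid b c := le_sup_right
    exact Setoid.trans' _ (h1 (x := a) (y := b) ⟨hx, Or.inr (Or.inl ⟨rfl, rfl⟩)⟩)
      (h2 (Or.inr (Or.inl ⟨rfl, rfl⟩)))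

theorem exists_check_pair {α : Type*} [Finite α] (a b : α) :
    ∃ p : LatTerm (Setoid α), ∀ x : Setoid α,
      (x.r a b → p.eval x = ⊤) ∧ (¬ x.r a b → p.eval x = ⊥) := by
  classical
  have := Fintype.ofFinite α
  by_cases hab : a = b
  · subst hab
    exact ⟨.const ⊤, fun x => ⟨fun _ => rfl, fun h => absurd (x.refl' a) h⟩⟩
  have key : ∀ s : Finset (α × α), ∃ p : LatTerm (Setoid α), ∀ x : Setoid α,
      (¬ x.r a b → p.eval x = ⊥) ∧ (x.r a b → ∀ cd ∈ s, (p.eval x).r cd.1 cd.2) := by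
    intro s
    induction s using Finset.induction_on with
    | empty => exact ⟨.const ⊥, fun x => ⟨fun _ => rfl, by simp⟩⟩
    | insert e s _ ih =>
      obtain ⟨p, hp⟩ := ih
      obtain ⟨q, hq⟩ := (reach_left hab e.1).symm.trans (reach_left hab e.2)
      refine ⟨.join p q, fun x => ⟨fun hx => ?_, fun hx cd hcd => ?_⟩⟩
      · simp [LatTerm.eval, (hp x).1 hx, (hq x).1 hx]
      · have h1 : p.eval x ≤ p.eval x ⊔ q.eval x := le_sup_left
        have h2 : q.eval x ≤ p.eval x ⊔ q.eval x := le_sup_right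
        rcases Finset.mem_insert.1 hcd with rfl | hcd
        · exact h2 ((hq x).2 hx)
        · exact h1 ((hp x).2 hx cd hcd)
  obtain ⟨p, hp⟩ := key Finset.univ
  refine ⟨p, fun x => ⟨fun hx => ?_, (hp x).1⟩⟩
  rw [eq_top_iff]
  intro c d _
  exact (hp x).2 hx (c, d) (Finset.mem_univ _)

/-- Existence of the formula `checkgeb_A` over the partition lattice: for every
equivalence relation `A` on `Fin n` there is a unary lattice term `p` that
evaluates to `⊤` at every `x ≥ A` and to `⊥` at every `x` with `A ≰ x`. -/
theorem exists_checkgeb_term (n : ℕ) (A : Setoid (Fin n)) :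
    ∃ p : LatTerm (Setoid (Fin n)),
      ∀ x : Setoid (Fin n),
        (A ≤ x → p.eval x = ⊤) ∧ (¬ A ≤ x → p.eval x = ⊥) := by
  classical
  have key : ∀ s : Finset (Fin n × Fin n), ∃ p : LatTerm (Setoid (Fin n)),
      ∀ x : Setoid (Fin n),
      ((∀ e ∈ s, x.r e.1 e.2) → p.eval x = ⊤) ∧ (¬ (∀ e ∈ s, x.r e.1 e.2) → p.eval x = ⊥) := by
    intro s
    induction s using Finset.induction_on with
    | empty => exact ⟨.const ⊤, fun x => ⟨fun _ => rfl, by simp⟩⟩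
    | insert e s _ ih =>
      obtain ⟨p, hp⟩ := ih
      obtain ⟨q, hq⟩ := exists_check_pair e.1 e.2
      refine ⟨.meet p q, fun x => ⟨fun hx => ?_, fun hx => ?_⟩⟩
      · rw [Finset.forall_mem_insert] at hx
        simp [LatTerm.eval, (hp x).1 hx.2, (hq x).1 hx.1]
      · rw [Finset.forall_mem_insert, not_and_or] at hx
        rcases hx with hx | hx
        · simp [LatTerm.eval, (hq x).2 hx]
        · simp [LatTerm.eval, (hp x).2 hx]
  obtain ⟨p, hp⟩ := key (Finset.univ.filter fun e => A.r e.1 e.2)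
  have hiff : ∀ x : Setoid (Fin n), A ≤ x ↔
      ∀ e ∈ (Finset.univ.filter fun e : Fin n × Fin n => A.r e.1 e.2), x.r e.1 e.2 := by
    intro x
    constructor
    · intro h e he
      exact h (Finset.mem_filter.1 he).2
    · intro h a b hab
      exact h (a, b) (Finset.mem_filter.2 ⟨Finset.mem_univ _, hab⟩)
  refine ⟨p, fun x => ?_⟩
  rw [hiff x]
  exact hp x
end

section
/- Let D be a distributive lattice and let a, b, w, p, a', a'', b'' be elements of D such that a ≤ a', b'' ≤ a', a = (a'' ⊔ p) ⊓ w, and b = (b'' ⊔ p) ⊓ w. Then b ≤ a'. -/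
/-- Key order-theoretic lemma behind the impossibility of embedding the
`P`-simulating poset into a distributive lattice: in a distributive lattice,
if `a ≤ a'`, `b'' ≤ a'`, `a = (a'' ⊔ p) ⊓ w` and `b = (b'' ⊔ p) ⊓ w`,
then `b ≤ a'`. -/
theorem distrib_forces_le {D : Type*} [DistribLattice D]
    (a b w p a' a'' b'' : D)
    (ha : a ≤ a') (hb : b'' ≤ a')
    (haeq : a = (a'' ⊔ p) ⊓ w) (hbeq : b = (b'' ⊔ p) ⊓ w) :
    b ≤ a' := by
  rw [hbeq, inf_sup_right]
  refine sup_le (inf_le_left.trans hb) (le_trans ?_ ha)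
  rw [haeq]
  exact inf_le_inf_right w le_sup_right
end

section
/- Let D be a distributive lattice and let a, b, c, y, z, w, p be elements of D satisfying the four identities: (((a ⊔ c) ⊓ y) ⊔ z) ⊓ w = a, (((b ⊔ c) ⊓ y) ⊔ z) ⊓ w = b, ((a ⊓ c) ⊔ p) ⊓ w = a, and ((b ⊓ c) ⊔ p) ⊓ w = b. Then a = b. -/
theorem copy_config_le {D : Type*} [DistribLattice D]
    (a b c y z w p : D)
    (h1 : (((a ⊔ c) ⊓ y) ⊔ z) ⊓ w = a)
    (h2 : (((b ⊔ c) ⊓ y) ⊔ z) ⊓ w = b)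
    (h3 : ((a ⊓ c) ⊔ p) ⊓ w = a)
    (h4 : ((b ⊓ c) ⊔ p) ⊓ w = b) :
    a ≤ b := by
  have hw : a ≤ w := h3 ▸ inf_le_right
  have ha : a ≤ ((a ⊔ c) ⊓ y) ⊔ z := le_of_eq_of_le h1.symm inf_le_left
  have hp : p ⊓ w ≤ b := le_of_le_of_eq (inf_le_inf_right w le_sup_right) h4
  apply le_of_inf_le_sup_le (z := c)
  · refine le_inf ?_ inf_le_right
    refine le_of_le_of_eq (le_inf ?_ (inf_le_left.trans hw)) h2
    calc a ⊓ c ≤ (((a ⊔ c) ⊓ y) ⊔ z) ⊓ c := inf_le_inf_right c ha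
      _ = (((a ⊔ c) ⊓ y) ⊓ c) ⊔ (z ⊓ c) := inf_sup_right _ _ _
      _ ≤ ((b ⊔ c) ⊓ y) ⊔ z :=
        sup_le_sup (le_inf (inf_le_right.trans le_sup_right)
          (inf_le_left.trans inf_le_right)) inf_le_left
  · refine sup_le ?_ le_sup_right
    calc a = ((a ⊓ c) ⊓ w) ⊔ (p ⊓ w) := by rw [← inf_sup_right, h3]
      _ ≤ b ⊔ c := sup_le ((inf_le_left.trans inf_le_right).trans le_sup_right)
        (hp.trans le_sup_left)

/-- In a distributive lattice, any 'copy configuration' collapses: if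
`(((a ⊔ c) ⊓ y) ⊔ z) ⊓ w = a`, `(((b ⊔ c) ⊓ y) ⊔ z) ⊓ w = b`,
`((a ⊓ c) ⊔ p) ⊓ w = a` and `((b ⊓ c) ⊔ p) ⊓ w = b`, then `a = b`.
This is the paper's impossibility theorem for embedding the `P`-simulating
poset into a distributive lattice preserving existing meets and joins. -/
theorem distrib_copy_config_collapses {D : Type*} [DistribLattice D]
    (a b c y z w p : D)
    (h1 : (((a ⊔ c) ⊓ y) ⊔ z) ⊓ w = a)
    (h2 : (((b ⊔ c) ⊓ y) ⊔ z) ⊓ w = b)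
    (h3 : ((a ⊓ c) ⊔ p) ⊓ w = a)
    (h4 : ((b ⊓ c) ⊔ p) ⊓ w = b) :
    a = b := by
  exact le_antisymm (copy_config_le a b c y z w p h1 h2 h3 h4)
    (copy_config_le b a c y z w p h2 h1 h4 h3)
end

section
/- There exists a finite lattice L together with elements a, b, c, y, z, w, p ∈ L with a ≠ b satisfying the four identities: (((a ⊔ c) ⊓ y) ⊔ z) ⊓ w = a, (((b ⊔ c) ⊓ y) ⊔ z) ⊓ w = b, ((a ⊓ c) ⊔ p) ⊓ w = a, and ((b ⊓ c) ⊔ p) ⊓ w = b. -/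
/-- A 'copy configuration' for the pair `(a, b)` in a lattice: the four
identities that allow a fan-out-free comparator circuit to duplicate a value
from `{a, b}` using only meets and joins with constants. -/
def CopyConfig {L : Type*} [Lattice L] (a b c y z w p : L) : Prop :=
  (((a ⊔ c) ⊓ y) ⊔ z) ⊓ w = a ∧ (((b ⊔ c) ⊓ y) ⊔ z) ⊓ w = b ∧
  ((a ⊓ c) ⊔ p) ⊓ w = a ∧ ((b ⊓ c) ⊔ p) ⊓ w = b

/-- The six-element lattice `0 < d, e < b < 1`, `0 < p < 1`. -/
inductive Six : Type
  | bot | d | e | b | p | top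
  deriving DecidableEq

namespace Six

instance : Fintype Six :=
  ⟨{bot, d, e, b, p, top}, by intro x; cases x <;> decide⟩

/-- Join. -/
def join : Six → Six → Six
  | bot, x => x
  | x, bot => x
  | d, d => d
  | e, e => e
  | p, p => p
  | top, _ => top
  | _, top => top
  | p, _ => top
  | _, p => top
  | _, _ => b

/-- Meet. -/
def meet : Six → Six → Six
  | top, x => x
  | x, top => x
  | p, p => p
  | p, _ => bot
  | _, p => bot
  | b, x => x
  | x, b => x
  | d, d => d
  | e, e => e
  | _, _ => bot

/-- The lattice structure on `Six`. -/
@[reducible] def lat : Lattice Six :=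
  @Lattice.mk' Six ⟨join⟩ ⟨meet⟩
    (by change ∀ x y, join x y = join y x; decide)
    (by change ∀ x y z, join (join x y) z = join x (join y z); decide)
    (by change ∀ x y, meet x y = meet y x; decide)
    (by change ∀ x y z, meet (meet x y) z = meet x (meet y z); decide)
    (by change ∀ x y, join x (meet x y) = x; decide)
    (by change ∀ x y, meet x (join x y) = x; decide)

end Six

/-- There exists a finite lattice containing a copy configuration for a pair
of distinct elements (obtained in the paper from the Dedekind–MacNeille
completion of the poset of Figure 3); any such lattice is non-distributive. -/
theorem exists_finite_lattice_copy_config :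
    ∃ (L : Type) (i : Lattice L), ∃ _ : Fintype L, ∃ a b c y z w p : L,
      a ≠ b ∧ CopyConfig a b c y z w p := by
  exact ⟨Six, Six.lat, inferInstance, .bot, .b, .d, .e, .p, .b, .p, by decide, rfl, rfl, rfl, rfl⟩
end

section
/- Let D be a distributive lattice and let a', a'', b'', y, z be elements of D such that (a'' ⊔ y) ⊓ z = a' ⊓ z and b'' ≤ a'. Then (b'' ⊔ y) ⊓ z ≤ a' ⊓ z. In particular, there are no elements a', a'', b'', y, z in a distributive lattice satisfying (a'' ⊔ y) ⊓ z = a' ⊓ z and b'' ≤ a' together with a' ⊓ z < (b'' ⊔ y) ⊓ z. -/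
/-- Order-theoretic lemma behind the appendix impossibility theorem for the
growing poset family: in a distributive lattice, if `(a'' ⊔ y) ⊓ z = a' ⊓ z`
and `b'' ≤ a'`, then `(b'' ⊔ y) ⊓ z ≤ a' ⊓ z`; in particular no such elements
can additionally satisfy `a' ⊓ z < (b'' ⊔ y) ⊓ z`. -/
theorem growing_poset_distrib_obstruction {D : Type*} [DistribLattice D] :
    (∀ a' a'' b'' y z : D,
        (a'' ⊔ y) ⊓ z = a' ⊓ z → b'' ≤ a' → (b'' ⊔ y) ⊓ z ≤ a' ⊓ z) ∧
    ¬ ∃ a' a'' b'' y z : D,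
        (a'' ⊔ y) ⊓ z = a' ⊓ z ∧ b'' ≤ a' ∧ a' ⊓ z < (b'' ⊔ y) ⊓ z := by
  have key : ∀ a' a'' b'' y z : D,
      (a'' ⊔ y) ⊓ z = a' ⊓ z → b'' ≤ a' → (b'' ⊔ y) ⊓ z ≤ a' ⊓ z := by
    intro a' a'' b'' y z h hb
    rw [inf_sup_right]
    refine sup_le (inf_le_inf_right z hb) ?_
    rw [← h]
    exact inf_le_inf_right z le_sup_right
  refine ⟨key, ?_⟩
  rintro ⟨a', a'', b'', y, z, h, hb, hlt⟩
  exact absurd (key a' a'' b'' y z h hb) (not_le_of_gt hlt)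
end

section
/- For every natural number n ≥ 2 there exists a constant c > 0 such that for every natural number k and every lattice formula F in k variables over the lattice of equivalence relations on Fin n, there exists a lattice formula F' in the same k variables over the same lattice that computes the same function (i.e., F and F' evaluate equally under every assignment of equivalence relations to the variables) and whose depth is at most c · log₂(size(F) + 1). -/
/-- Lattice formulas in `k` variables over a lattice `L`: built from variables,
constants from `L`, and binary meets and joins. -/
inductive LatFormula (L : Type*) (k : ℕ) where
  | var : Fin k → LatFormula L k
  | const : L → LatFormula L k
  | meet : LatFormula L k → LatFormula L k → LatFormula L k
  | join : LatFormula L k → LatFormula L k → LatFormula L k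

/-- Evaluation of a lattice formula under an assignment to the variables. -/
def LatFormula.eval {L : Type*} [Lattice L] {k : ℕ} :
    LatFormula L k → (Fin k → L) → L
  | .var i, v => v i
  | .const a, _ => a
  | .meet F G, v => F.eval v ⊓ G.eval v
  | .join F G, v => F.eval v ⊔ G.eval v

/-- The size of a lattice formula: its number of leaves. -/
def LatFormula.size {L : Type*} {k : ℕ} : LatFormula L k → ℕ
  | .var _ => 1
  | .const _ => 1
  | .meet F G => F.size + G.size
  | .join F G => F.size + G.size

/-- The depth of a lattice formula: the length of the longest root-to-leaf path. -/
def LatFormula.depth {L : Type*} {k : ℕ} : LatFormula L k → ℕ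
  | .var _ => 0
  | .const _ => 0
  | .meet F G => max F.depth G.depth + 1
  | .join F G => max F.depth G.depth + 1

namespace SpiraAux

open LatFormula

/-- Iterated join of a list of formulas. -/
def bigJoin {L : Type*} [LE L] [OrderBot L] {k : ℕ} :
    List (LatFormula L k) → LatFormula L k
  | [] => .const ⊥
  | F :: l => .join F (bigJoin l)

/-- Iterated meet of a list of formulas. -/
def bigMeet {L : Type*} [LE L] [OrderTop L] {k : ℕ} :
    List (LatFormula L k) → LatFormula L k
  | [] => .const ⊤
  | F :: l => .meet F (bigMeet l)

/-- The partition whose only nontrivial block is `{i, j}`. -/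
def atom {n : ℕ} (i j : Fin n) : Setoid (Fin n) where
  r x y := x = y ∨ (x = i ∧ y = j) ∨ (x = j ∧ y = i)
  iseqv := ⟨fun _ => Or.inl rfl, by grind, by grind⟩

lemma atom_rel {n : ℕ} (i j x y : Fin n) :
    atom i j x y ↔ x = y ∨ (x = i ∧ y = j) ∨ (x = j ∧ y = i) := Iff.rfl

section general
variable {n k : ℕ}

local notation "L" => Setoid (Fin n)

lemma depth_bigJoin (d : ℕ) (l : List (LatFormula L k)) (h : ∀ F ∈ l, F.depth ≤ d) :
    (bigJoin l).depth ≤ d + l.length := by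
  induction l with
  | nil => simp [bigJoin, depth]
  | cons F l ih =>
    have h1 := h F (by simp)
    have h2 := ih (fun G hG => h G (by simp [hG]))
    simp only [bigJoin, depth, List.length_cons]
    omega

lemma depth_bigMeet (d : ℕ) (l : List (LatFormula L k)) (h : ∀ F ∈ l, F.depth ≤ d) :
    (bigMeet l).depth ≤ d + l.length := by
  induction l with
  | nil => simp [bigMeet, depth]
  | cons F l ih =>
    have h1 := h F (by simp)
    have h2 := ih (fun G hG => h G (by simp [hG]))
    simp only [bigMeet, depth, List.length_cons]
    omega

lemma le_bigJoin (v : Fin k → L) (l : List (LatFormula L k)) (F : LatFormula L k) (h : F ∈ l) :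
    F.eval v ≤ (bigJoin l).eval v := by
  induction l with
  | nil => simp at h
  | cons G l ih =>
    rcases List.mem_cons.1 h with rfl | h
    · exact le_sup_left
    · exact (ih h).trans le_sup_right

lemma bigJoin_le (v : Fin k → L) (l : List (LatFormula L k)) (a : L)
    (h : ∀ F ∈ l, F.eval v ≤ a) : (bigJoin l).eval v ≤ a := by
  induction l with
  | nil => exact bot_le
  | cons G l ih =>
    exact sup_le (h G (by simp)) (ih fun F hF => h F (by simp [hF]))

lemma bigMeet_le (v : Fin k → L) (l : List (LatFormula L k)) (F : LatFormula L k) (h : F ∈ l) :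
    (bigMeet l).eval v ≤ F.eval v := by
  induction l with
  | nil => simp at h
  | cons G l ih =>
    rcases List.mem_cons.1 h with rfl | h
    · exact inf_le_left
    · exact inf_le_right.trans (ih h)

lemma le_bigMeet (v : Fin k → L) (l : List (LatFormula L k)) (a : L)
    (h : ∀ F ∈ l, a ≤ F.eval v) : a ≤ (bigMeet l).eval v := by
  induction l with
  | nil => exact le_top
  | cons G l ih =>
    exact le_inf (h G (by simp)) (ih fun F hF => h F (by simp [hF]))

/-- The indicator of `i ~ j` as a lattice polynomial. -/
lemma exists_pair (i j : Fin n) (H : LatFormula L k) :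
    ∃ I : LatFormula L k, I.depth ≤ H.depth + (n + 3) ∧
      ∀ v, (H.eval v i j → I.eval v = ⊤) ∧ (¬ H.eval v i j → I.eval v = ⊥) := by
  by_cases hij : i = j
  · subst hij
    exact ⟨.const ⊤, by simp [depth], fun v => ⟨fun _ => rfl, fun h => (h (Setoid.refl' _ _)).elim⟩⟩
  let f : Fin n → LatFormula L k := fun l =>
    .meet (.join (.meet H (.const (atom i j))) (.const (atom j l))) (.const (atom i l))
  refine ⟨bigJoin ((List.finRange n).map f), ?_, ?_⟩
  · refine (depth_bigJoin (H.depth + 3) _ ?_).trans (by simp; omega)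
    intro F hF
    obtain ⟨l, -, rfl⟩ := List.mem_map.1 hF
    simp [f, depth]
  · intro v
    refine ⟨fun h => ?_, fun h => ?_⟩
    · have key : ∀ l, (bigJoin ((List.finRange n).map f)).eval v i l := by
        intro l
        refine le_bigJoin v _ (f l) (List.mem_map.2 ⟨l, by simp, rfl⟩) ?_
        refine ⟨?_, Or.inr (Or.inl ⟨rfl, rfl⟩)⟩
        have h1 : (H.eval v ⊓ atom i j ⊔ atom j l : L) i j :=
          (le_sup_left : (H.eval v ⊓ atom i j : L) ≤ _) ⟨h, Or.inr (Or.inl ⟨rfl, rfl⟩)⟩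
        have h2 : (H.eval v ⊓ atom i j ⊔ atom j l : L) j l :=
          (le_sup_right : (atom j l : L) ≤ _) (Or.inr (Or.inl ⟨rfl, rfl⟩))
        exact Setoid.trans' _ h1 h2
      refine top_le_iff.1 fun x y _ => ?_
      exact Setoid.trans' _ (Setoid.symm' _ (key x)) (key y)
    · refine le_bot_iff.1 (bigJoin_le v _ _ fun F hF => ?_)
      obtain ⟨l, -, rfl⟩ := List.mem_map.1 hF
      have h0 : (H.eval v ⊓ atom i j : L) = ⊥ := by
        refine le_bot_iff.1 ?_
        rintro x y ⟨h1, h2⟩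
        rcases h2 with rfl | ⟨rfl, rfl⟩ | ⟨rfl, rfl⟩
        · rfl
        · exact (h h1).elim
        · exact (h (Setoid.symm' _ h1)).elim
      simp only [f, eval, h0, bot_sup_eq]
      rintro x y ⟨h1, h2⟩
      change x = y
      change x = y ∨ _ at h1
      change x = y ∨ _ at h2
      grind

/-- The indicator of `a ≤ h` as a lattice polynomial. -/
lemma exists_ind (a : L) (H : LatFormula L k) :
    ∃ I : LatFormula L k, I.depth ≤ H.depth + (n + 3) + n * n ∧
      ∀ v, (a ≤ H.eval v → I.eval v = ⊤) ∧ (¬ a ≤ H.eval v → I.eval v = ⊥) := by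
  classical
  choose P hP1 hP2 using fun i j : Fin n => exists_pair i j H
  let f : Fin n × Fin n → LatFormula L k := fun p => if a p.1 p.2 then P p.1 p.2 else .const ⊤
  refine ⟨bigMeet ((Finset.univ : Finset (Fin n × Fin n)).toList.map f), ?_, fun v => ⟨?_, ?_⟩⟩
  · refine (depth_bigMeet (H.depth + (n + 3)) _ ?_).trans (by simp)
    intro F hF
    obtain ⟨p, -, rfl⟩ := List.mem_map.1 hF
    simp only [f]
    split_ifs
    · exact hP1 _ _
    · simp [depth]
  · intro h
    refine top_le_iff.1 (le_bigMeet v _ _ fun F hF => ?_)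
    obtain ⟨p, -, rfl⟩ := List.mem_map.1 hF
    simp only [f]
    split_ifs with hp
    · rw [(hP2 p.1 p.2 v).1 (h hp)]
    · exact le_rfl
  · intro h
    have : ∃ i j, a i j ∧ ¬ H.eval v i j := by
      by_contra hc
      push Not at hc
      exact h fun x y hxy => hc x y hxy
    obtain ⟨i, j, h1, h2⟩ := this
    refine le_bot_iff.1 ((bigMeet_le v _ (f (i, j)) (List.mem_map.2 ⟨(i, j), by simp, rfl⟩)).trans ?_)
    simp only [f, if_pos h1]
    rw [(hP2 i j v).2 h2]

/-- Spira decomposition. -/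
lemma decomp (s : ℕ) (hs : 2 ≤ s) (F : LatFormula L k) (hF : s < 2 * F.size) :
    ∃ (A B H : LatFormula L k) (G : L → LatFormula L k),
      (H = .meet A B ∨ H = .join A B) ∧ 2 * A.size ≤ s ∧ 2 * B.size ≤ s ∧ s < 2 * H.size ∧
      (∀ a, (G a).size + H.size = F.size + 1) ∧
      (∀ v, Monotone fun a => (G a).eval v) ∧
      ∀ v, (G (H.eval v)).eval v = F.eval v := by
  induction F with
  | var i => simp [size] at hF; omega
  | const a => simp [size] at hF; omega
  | meet A B ihA ihB =>
    by_cases hA : s < 2 * A.size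
    · obtain ⟨A', B', H, G, h1, h2, h3, h7, h4, h5, h6⟩ := ihA hA
      refine ⟨A', B', H, fun a => .meet (G a) B, h1, h2, h3, h7, fun a => ?_, fun v x y hxy => ?_,
        fun v => ?_⟩
      · have := h4 a
        simp only [size]; omega
      · exact inf_le_inf_right _ (h5 v hxy)
      · simp only [eval, h6]
    by_cases hB : s < 2 * B.size
    · obtain ⟨A', B', H, G, h1, h2, h3, h7, h4, h5, h6⟩ := ihB hB
      refine ⟨A', B', H, fun a => .meet A (G a), h1, h2, h3, h7, fun a => ?_, fun v x y hxy => ?_,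
        fun v => ?_⟩
      · have := h4 a
        simp only [size]; omega
      · exact inf_le_inf_left _ (h5 v hxy)
      · simp only [eval, h6]
    exact ⟨A, B, .meet A B, .const, Or.inl rfl, by omega, by omega, hF,
      fun a => by simp only [size]; omega, fun v x y hxy => hxy, fun v => rfl⟩
  | join A B ihA ihB =>
    by_cases hA : s < 2 * A.size
    · obtain ⟨A', B', H, G, h1, h2, h3, h7, h4, h5, h6⟩ := ihA hA
      refine ⟨A', B', H, fun a => .join (G a) B, h1, h2, h3, h7, fun a => ?_, fun v x y hxy => ?_,
        fun v => ?_⟩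
      · have := h4 a
        simp only [size]; omega
      · exact sup_le_sup_right (h5 v hxy) _
      · simp only [eval, h6]
    by_cases hB : s < 2 * B.size
    · obtain ⟨A', B', H, G, h1, h2, h3, h7, h4, h5, h6⟩ := ihB hB
      refine ⟨A', B', H, fun a => .join A (G a), h1, h2, h3, h7, fun a => ?_, fun v x y hxy => ?_,
        fun v => ?_⟩
      · have := h4 a
        simp only [size]; omega
      · exact sup_le_sup_left (h5 v hxy) _
      · simp only [eval, h6]
    exact ⟨A, B, .join A B, .const, Or.inr rfl, by omega, by omega, hF,
      fun a => by simp only [size]; omega, fun v x y hxy => hxy, fun v => rfl⟩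

lemma size_pos (F : LatFormula L k) : 1 ≤ F.size := by
  induction F with
  | var i => exact le_rfl
  | const a => exact le_rfl
  | meet A B hA hB => simp only [size]; omega
  | join A B hA hB => simp only [size]; omega

/-- The additive cost of one step. -/
noncomputable def cost (n : ℕ) : ℕ := 1 + (n + 3) + n * n + 1 + Nat.card (Setoid (Fin n))

lemma main (m : ℕ) : ∀ F : LatFormula L k, F.size ≤ 2 ^ m →
    ∃ F' : LatFormula L k, (∀ v, F'.eval v = F.eval v) ∧ F'.depth ≤ cost n * m := by
  classical
  induction m with
  | zero =>
    intro F hF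
    refine ⟨F, fun _ => rfl, ?_⟩
    cases F with
    | var i => simp [depth]
    | const a => simp [depth]
    | meet A B =>
      have := size_pos A
      have := size_pos B
      simp only [size, pow_zero] at hF; omega
    | join A B =>
      have := size_pos A
      have := size_pos B
      simp only [size, pow_zero] at hF; omega
  | succ m ih =>
    intro F hF
    by_cases hsm : F.size ≤ 2 ^ m
    · obtain ⟨F', h1, h2⟩ := ih F hsm
      exact ⟨F', h1, h2.trans (Nat.mul_le_mul_left _ (Nat.le_succ m))⟩
    have hpos : 1 ≤ 2 ^ m := Nat.one_le_two_pow
    rw [pow_succ] at hF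
    obtain ⟨A, B, H, G, h1, h2, h3, h7, h4, h5, h6⟩ := decomp F.size (by omega) F (by omega)
    obtain ⟨A', hA1, hA2⟩ := ih A (by omega)
    obtain ⟨B', hB1, hB2⟩ := ih B (by omega)
    have hHs : H.size = A.size + B.size := by rcases h1 with rfl | rfl <;> rfl
    have hH : ∃ H' : LatFormula L k, (∀ v, H'.eval v = H.eval v) ∧
        H'.depth ≤ cost n * m + 1 := by
      rcases h1 with rfl | rfl
      · exact ⟨.meet A' B', fun v => by simp only [eval, hA1, hB1], by simp only [depth]; omega⟩
      · exact ⟨.join A' B', fun v => by simp only [eval, hA1, hB1], by simp only [depth]; omega⟩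
    obtain ⟨H', hH1, hH2⟩ := hH
    have hGs : ∀ a, (G a).size ≤ 2 ^ m := by
      intro a
      have := h4 a
      omega
    choose K hK1 hK2 using fun a => ih (G a) (hGs a)
    choose I hI1 hI2 using fun a => exists_ind a H'
    have : Finite L := Finite.of_injective (fun (r : L) (x y : Fin n) => r x y) (by
      intro r s hrs
      ext x y
      exact iff_of_eq (congrFun (congrFun hrs x) y))
    have : Fintype L := Fintype.ofFinite L
    let f : L → LatFormula L k := fun a => .meet (I a) (K a)
    refine ⟨bigJoin ((Finset.univ : Finset L).toList.map f), fun v => ?_, ?_⟩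
    · refine le_antisymm (bigJoin_le v _ _ fun F₁ hF₁ => ?_) ?_
      · obtain ⟨a, -, rfl⟩ := List.mem_map.1 hF₁
        simp only [f, eval]
        by_cases ha : a ≤ H'.eval v
        · rw [hK1, ← h6]
          rw [hH1] at ha
          exact inf_le_right.trans (h5 v ha)
        · rw [(hI2 a v).2 ha, bot_inf_eq]
          exact bot_le
      · refine le_trans ?_ (le_bigJoin v _ (f (H.eval v)) (List.mem_map.2 ⟨_, by simp, rfl⟩))
        simp only [f, eval]
        rw [(hI2 _ v).1 (hH1 v).ge, hK1, h6, top_inf_eq]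
    · have hd : ∀ F₁ ∈ (Finset.univ : Finset L).toList.map f,
          F₁.depth ≤ cost n * m + 1 + (n + 3) + n * n + 1 := by
        intro F₁ hF₁
        obtain ⟨a, -, rfl⟩ := List.mem_map.1 hF₁
        have e1 := hI1 a
        have e2 := hK2 a
        simp only [f, depth]
        omega
      refine (depth_bigJoin _ _ hd).trans ?_
      rw [Nat.mul_succ]
      simp only [List.length_map, Finset.length_toList, Finset.card_univ, cost,
        Nat.card_eq_fintype_card]
      omega

end general

end SpiraAux

/-- Spira's depth-reduction theorem over partition lattices: for every `n ≥ 2`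
there is a constant `c > 0` such that every lattice formula `F` in `k`
variables over the lattice of equivalence relations on `Fin n` is equivalent
to a formula `F'` in the same variables of depth at most `c · log₂(size F + 1)`. -/
theorem spira_partition_lattice (n : ℕ) (hn : 2 ≤ n) :
    ∃ c : ℝ, 0 < c ∧
      ∀ (k : ℕ) (F : LatFormula (Setoid (Fin n)) k),
        ∃ F' : LatFormula (Setoid (Fin n)) k,
          (∀ v : Fin k → Setoid (Fin n), F'.eval v = F.eval v) ∧
          (F'.depth : ℝ) ≤ c * Real.logb 2 (F.size + 1) := by
  have hc : 0 < SpiraAux.cost n := by unfold SpiraAux.cost; omega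
  refine ⟨2 * SpiraAux.cost n, by positivity, fun k F => ?_⟩
  obtain ⟨F', h1, h2⟩ := SpiraAux.main (Nat.log 2 F.size + 1) F
    (Nat.lt_pow_succ_log_self (by norm_num) _).le
  refine ⟨F', h1, ?_⟩
  have hs : (1 : ℝ) ≤ F.size := by exact_mod_cast SpiraAux.size_pos F
  have e1 : (Nat.log 2 F.size : ℝ) ≤ Real.logb 2 (F.size + 1) :=
    (Real.natLog_le_logb F.size 2).trans
      (Real.logb_le_logb_of_le (by norm_num) (by linarith) (by linarith))
  have e2 : (1 : ℝ) ≤ Real.logb 2 (F.size + 1) := by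
    rw [Real.le_logb_iff_rpow_le (by norm_num) (by linarith)]
    simp; linarith
  have h3 : (F'.depth : ℝ) ≤ SpiraAux.cost n * (Nat.log 2 F.size + 1) := by exact_mod_cast h2
  refine h3.trans ?_
  have : (0 : ℝ) ≤ SpiraAux.cost n := by positivity
  nlinarith
end
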